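/- Let b be an optimal allocation of B bits and let b′ be any allocation of B + 1 bits. Then there exists an index m with b′_m ≥ b_m + 1, and for every such index m the allocation obtained from b by adding one bit to component m has total distortion at most that of b′: D(b + e_m) ≤ D(b′), where (b + e_m)_m = b_m + 1 and (b + e_m)_n = b_n for n ≠ m. (The key step, inequalities (20)–(22), in the proof of Proposition 1.) -/

import Mathlib

open Finset

theorem sum_update_add_one {ι : Type*} [Fintype ι] [DecidableEq ι] (c : ι → ℕ) (m : ι) :
    ∑ n, Function.update c m (c m + 1) n = ∑ n, c n + 1 := by
  rw [sum_update_of_mem (mem_univ m), sdiff_singleton_eq_erase,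
    ← add_sum_erase univ c (mem_univ m)]
  ring

/-- Adding one bit to component `m` lowers the total distortion by the new distortion of `m`. -/
theorem distortion_update_add_one {ι : Type*} [Fintype ι] [DecidableEq ι] (σ : ι → ℝ)
    (c : ι → ℕ) (m : ι) :
    ∑ n, σ n * (2 : ℝ) ^ (-((Function.update c m (c m + 1) n : ℕ) : ℤ)) =
      ∑ n, σ n * (2 : ℝ) ^ (-(c n : ℤ)) - σ m * (2 : ℝ) ^ (-((c m + 1 : ℕ) : ℤ)) := by
  rw [← add_sum_erase univ _ (mem_univ m),
    ← add_sum_erase univ (fun n => σ n * (2 : ℝ) ^ (-(c n : ℤ))) (mem_univ m)]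
  have hrest : ∑ n ∈ univ.erase m,
      σ n * (2 : ℝ) ^ (-((Function.update c m (c m + 1) n : ℕ) : ℤ)) =
        ∑ n ∈ univ.erase m, σ n * (2 : ℝ) ^ (-(c n : ℤ)) :=
    sum_congr rfl fun n hn => by rw [Function.update_of_ne (ne_of_mem_erase hn)]
  have hhalf : (2 : ℝ) ^ (-(c m : ℤ)) = 2 * (2 : ℝ) ^ (-((c m + 1 : ℕ) : ℤ)) := by
    rw [← zpow_one_add₀ (two_ne_zero' ℝ)]
    congr 1
    push_cast
    ring
  rw [hrest, Function.update_self, hhalf]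
  ring

/-- Key step in the proof of Proposition 1: if `b` is an optimal allocation of `B` bits
and `b'` is any allocation of `B + 1` bits, then some index `m` satisfies
`b' m ≥ b m + 1`, and for every such `m` the allocation `b + e_m` has total
distortion at most that of `b'`. -/
theorem optimal_allocation_key_step
    {N : ℕ} (hN : 1 ≤ N) (σ : Fin N → ℝ) (hσ : ∀ n, 0 ≤ σ n)
    (B : ℕ) (b : Fin N → ℕ) (hb : ∑ n, b n = B)
    (hopt : ∀ c : Fin N → ℕ, ∑ n, c n = B →
      ∑ n, σ n * (2 : ℝ) ^ (-(b n : ℤ)) ≤ ∑ n, σ n * (2 : ℝ) ^ (-(c n : ℤ)))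
    (b' : Fin N → ℕ) (hb' : ∑ n, b' n = B + 1) :
    (∃ m : Fin N, b m + 1 ≤ b' m) ∧
    (∀ m : Fin N, b m + 1 ≤ b' m →
      ∑ n, σ n * (2 : ℝ) ^ (-((Function.update b m (b m + 1) n : ℕ) : ℤ)) ≤
        ∑ n, σ n * (2 : ℝ) ^ (-(b' n : ℤ))) := by
  refine ⟨?_, fun m hm => ?_⟩
  · by_contra! h
    have : ∑ n, b' n ≤ ∑ n, b n := sum_le_sum fun n _ => Nat.lt_succ_iff.mp (h n)
    omega
  · obtain ⟨c, rfl⟩ : ∃ c : Fin N → ℕ, b' = Function.update c m (c m + 1) := by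
      refine ⟨Function.update b' m (b' m - 1), ?_⟩
      rw [Function.update_self, Function.update_idem, Nat.sub_add_cancel (by omega),
        Function.update_eq_self]
    rw [sum_update_add_one] at hb'
    rw [Function.update_self] at hm
    rw [distortion_update_add_one, distortion_update_add_one]
    have hpow : (2 : ℝ) ^ (-((c m + 1 : ℕ) : ℤ)) ≤ (2 : ℝ) ^ (-((b m + 1 : ℕ) : ℤ)) :=
      zpow_le_zpow_right₀ one_le_two (by omega)
    exact sub_le_sub (hopt c (by omega)) (mul_le_mul_of_nonneg_left hpow (hσ m))
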